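/- arXiv:2204.02954 — 3 statements merged into one kernel-verified Lean document; each statement's English description precedes it below -/
import Mathlib

section
/- Let n > 0 be real, let m ≥ 4 and k ≥ 1 be natural numbers, and let θ_m be a random variable with the Erlang (Gamma) distribution of shape m and rate n. Then the 2k-th central moment satisfies E[(θ_m − m/n)^{2k}] ≤ 2·√m·(2k·√m / n)^{2k}. -/
open MeasureTheory ProbabilityTheory

/-- The density of the Gamma distribution times a monomial, as an indicator on `(0, ∞)`. -/
lemma gammaPDF_toReal_smul_pow_ae_eq {a r : ℝ} (ha : 0 < a) (hr : 0 < r) (i : ℕ) :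
    (fun x : ℝ ↦ (gammaPDF a r x).toReal • x ^ i) =ᵐ[volume]
      (Set.Ioi (0 : ℝ)).indicator
        (fun x ↦ r ^ a / Real.Gamma a * (x ^ (a + i - 1) * Real.exp (-(r * x)))) := by
  filter_upwards [Measure.ae_ne volume (0 : ℝ)] with x hx
  rcases lt_or_gt_of_ne hx with h | h
  · simp [gammaPDF_of_neg h, h.le]
  · rw [Set.indicator_of_mem (Set.mem_Ioi.mpr h), gammaPDF,
      ENNReal.toReal_ofReal (gammaPDFReal_nonneg ha hr x), gammaPDFReal, if_pos h.le, smul_eq_mul,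
      show a + i - 1 = (a - 1) + (i : ℝ) by ring, Real.rpow_add h, Real.rpow_natCast]
    ring

lemma integrable_pow_gammaMeasure {a r : ℝ} (ha : 0 < a) (hr : 0 < r) (i : ℕ) :
    Integrable (fun x : ℝ ↦ x ^ i) (gammaMeasure a r) := by
  rw [gammaMeasure, integrable_withDensity_iff_integrable_smul' (f := gammaPDF a r)
    (measurable_gammaPDFReal a r).ennreal_ofReal (by simp [gammaPDF]),
    integrable_congr (gammaPDF_toReal_smul_pow_ae_eq ha hr i),
    integrable_indicator_iff measurableSet_Ioi]
  have hi : (0 : ℝ) ≤ i := i.cast_nonneg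
  have := integrableOn_rpow_mul_exp_neg_mul_rpow (s := a + i - 1) (p := 1) (b := r)
    (by linarith) one_pos hr
  simpa [IntegrableOn] using this.const_mul (r ^ a / Real.Gamma a)

lemma integral_pow_gammaMeasure {a r : ℝ} (ha : 0 < a) (hr : 0 < r) (i : ℕ) :
    ∫ x, x ^ i ∂(gammaMeasure a r) =
      r ^ a / Real.Gamma a * ((1 / r) ^ (a + i) * Real.Gamma (a + i)) := by
  rw [gammaMeasure, integral_withDensity_eq_integral_toReal_smul (f := gammaPDF a r)
    (measurable_gammaPDFReal a r).ennreal_ofReal (by simp [gammaPDF]),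
    integral_congr_ae (gammaPDF_toReal_smul_pow_ae_eq ha hr i),
    integral_indicator measurableSet_Ioi, integral_const_mul,
    Real.integral_rpow_mul_exp_neg_mul_Ioi (by positivity) hr]

lemma integral_pow_succ_gammaMeasure {a r : ℝ} (ha : 0 < a) (hr : 0 < r) (i : ℕ) :
    r * ∫ x, x ^ (i + 1) ∂(gammaMeasure a r) =
      (a + i) * ∫ x, x ^ i ∂(gammaMeasure a r) := by
  have hai : 0 < a + i := by positivity
  rw [integral_pow_gammaMeasure ha hr, integral_pow_gammaMeasure ha hr, Nat.cast_succ,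
    ← add_assoc, Real.Gamma_add_one hai.ne', Real.rpow_add_one (by positivity)]
  field_simp

lemma integrable_eval_gammaMeasure {a r : ℝ} (ha : 0 < a) (hr : 0 < r) (p : Polynomial ℝ) :
    Integrable (fun x ↦ p.eval x) (gammaMeasure a r) := by
  induction p using Polynomial.induction_on' with
  | add p q hp hq => exact (hp.add hq).congr (.of_forall fun x ↦ by simp)
  | monomial i c => simpa using (integrable_pow_gammaMeasure ha hr i).const_mul c

/-- Stein's identity for the Gamma distribution and polynomial test functions. -/
lemma integral_X_mul_gammaMeasure {a r : ℝ} (ha : 0 < a) (hr : 0 < r) (p : Polynomial ℝ) :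
    r * ∫ x, x * p.eval x ∂(gammaMeasure a r) =
      a * (∫ x, p.eval x ∂(gammaMeasure a r)) +
        ∫ x, x * p.derivative.eval x ∂(gammaMeasure a r) := by
  have hint (q : Polynomial ℝ) : Integrable (fun x ↦ x * q.eval x) (gammaMeasure a r) := by
    exact (integrable_eval_gammaMeasure ha hr (Polynomial.X * q)).congr
      (.of_forall fun x ↦ by simp)
  induction p using Polynomial.induction_on' with
  | add p q hp hq =>
    simp only [Polynomial.eval_add, Polynomial.derivative_add, mul_add]
    rw [integral_add (hint p) (hint q), integral_add (hint _) (hint _),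
      integral_add (integrable_eval_gammaMeasure ha hr p) (integrable_eval_gammaMeasure ha hr q)]
    linarith
  | monomial i c =>
    have h1 : ∀ x : ℝ, x * (Polynomial.monomial i c).eval x = c * x ^ (i + 1) := fun x ↦ by
      rw [Polynomial.eval_monomial]; ring
    have h2 : ∀ x : ℝ, x * (Polynomial.monomial i c).derivative.eval x = (c * i) * x ^ i := by
      intro x
      rw [Polynomial.derivative_monomial, Polynomial.eval_monomial]
      rcases i with _ | i
      · simp
      · rw [Nat.add_sub_cancel]; ring
    simp only [h1, h2, integral_const_mul]
    simp only [Polynomial.eval_monomial, integral_const_mul]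
    linear_combination c * integral_pow_succ_gammaMeasure ha hr i

lemma integral_centered_pow_succ_gammaMeasure {a r : ℝ} (ha : 0 < a) (hr : 0 < r) (j : ℕ) :
    ∫ x, (x - a / r) ^ (j + 2) ∂(gammaMeasure a r) =
      (j + 1) / r * ((∫ x, (x - a / r) ^ (j + 1) ∂(gammaMeasure a r)) +
        a / r * ∫ x, (x - a / r) ^ j ∂(gammaMeasure a r)) := by
  have hint (i : ℕ) : Integrable (fun x ↦ (x - a / r) ^ i) (gammaMeasure a r) := by
    exact (integrable_eval_gammaMeasure ha hr ((Polynomial.X - Polynomial.C (a / r)) ^ i)).congr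
      (.of_forall fun x ↦ by simp)
  have h := integral_X_mul_gammaMeasure ha hr
    ((Polynomial.X - Polynomial.C (a / r)) ^ (j + 1))
  have split (i : ℕ) : ∫ x, x * (x - a / r) ^ i ∂(gammaMeasure a r) =
      (∫ x, (x - a / r) ^ (i + 1) ∂(gammaMeasure a r)) +
        a / r * ∫ x, (x - a / r) ^ i ∂(gammaMeasure a r) := by
    rw [← integral_const_mul, ← integral_add (hint _) ((hint _).const_mul _)]
    exact integral_congr_ae (.of_forall fun x ↦ by ring)
  have hder : ∀ x : ℝ, x * ((Polynomial.X - Polynomial.C (a / r)) ^ (j + 1)).derivative.eval x =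
      (j + 1) * (x * (x - a / r) ^ j) := fun x ↦ by
    simp [Polynomial.derivative_pow]; ring
  simp only [hder, integral_const_mul, Polynomial.eval_pow, Polynomial.eval_sub,
    Polynomial.eval_X, Polynomial.eval_C, split] at h
  field_simp at h ⊢
  linarith

lemma integral_centered_pow_one_gammaMeasure {a r : ℝ} (ha : 0 < a) (hr : 0 < r) :
    ∫ x, (x - a / r) ∂(gammaMeasure a r) = 0 := by
  have := isProbabilityMeasure_gammaMeasure ha hr
  have h := integral_pow_succ_gammaMeasure ha hr 0
  have hi := integrable_pow_gammaMeasure ha hr 1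
  simp only [zero_add, pow_one, pow_zero, integral_const, probReal_univ, smul_eq_mul,
    Nat.cast_zero, add_zero, mul_one] at h hi
  rw [integral_sub hi (integrable_const _), integral_const, probReal_univ, one_smul]
  field_simp
  linarith

lemma integral_centered_pow_gammaMeasure_le {a r : ℝ} (ha : 1 ≤ a) (hr : 0 < r) (j : ℕ) :
    ∫ x, (x - a / r) ^ j ∂(gammaMeasure a r) ≤ j.factorial * (Real.sqrt a / r) ^ j := by
  have ha0 : 0 < a := by linarith
  have := isProbabilityMeasure_gammaMeasure ha0 hr
  induction j using Nat.twoStepInduction with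
  | zero => simp
  | one =>
    simp only [pow_one]
    rw [integral_centered_pow_one_gammaMeasure ha0 hr]
    positivity
  | more j h0 h1 =>
    rw [integral_centered_pow_succ_gammaMeasure ha0 hr]
    set s := Real.sqrt a with hs
    have hs1 : 1 ≤ s := Real.one_le_sqrt.mpr ha
    have hsa : a = s * s := (Real.mul_self_sqrt ha0.le).symm
    calc (j + 1) / r * ((∫ x, (x - a / r) ^ (j + 1) ∂(gammaMeasure a r)) +
          a / r * ∫ x, (x - a / r) ^ j ∂(gammaMeasure a r))
        ≤ (j + 1) / r * ((j + 1).factorial * (s / r) ^ (j + 1) +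
          a / r * (j.factorial * (s / r) ^ j)) := by gcongr
      _ = (j + 1).factorial * (s / r) ^ (j + 1) / r * ((j + 1) * 1 + s) := by
        rw [Nat.factorial_succ, hsa, pow_succ]; push_cast; ring
      _ ≤ (j + 1).factorial * (s / r) ^ (j + 1) / r * ((j + 1) * s + s) := by gcongr
      _ = (j + 2).factorial * (s / r) ^ (j + 2) := by
        rw [Nat.factorial_succ (j + 1), pow_succ _ (j + 1)]; push_cast; ring

/-- If `θ` has the Erlang (Gamma) distribution with shape `m ≥ 4` and
rate `n > 0`, then for every `k ≥ 1` the `2k`-th central moment satisfies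
`E[(θ − m/n)^{2k}] ≤ 2·√m·(2k·√m/n)^{2k}`. -/
theorem stmt2
    {Ω : Type*} [MeasurableSpace Ω] (μ : Measure Ω) [IsProbabilityMeasure μ]
    (n : ℝ) (hn : 0 < n) (m k : ℕ) (hm : 4 ≤ m) (hk : 1 ≤ k)
    (θ : Ω → ℝ) (hθmeas : Measurable θ)
    (hθ : μ.map θ = gammaMeasure m n) :
    ∫ ω, (θ ω - m / n) ^ (2 * k) ∂μ
      ≤ 2 * Real.sqrt m * (2 * k * Real.sqrt m / n) ^ (2 * k) := by
  have hm1 : (1 : ℝ) ≤ m := by exact_mod_cast (by omega : 1 ≤ m)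
  have hs : 1 ≤ Real.sqrt m := Real.one_le_sqrt.mpr hm1
  rw [← integral_map (f := fun x : ℝ ↦ (x - m / n) ^ (2 * k)) hθmeas.aemeasurable
    (by fun_prop), hθ]
  calc ∫ x, (x - m / n) ^ (2 * k) ∂(gammaMeasure m n)
      ≤ (2 * k).factorial * (Real.sqrt m / n) ^ (2 * k) :=
        integral_centered_pow_gammaMeasure_le hm1 hn _
    _ ≤ ((2 * k : ℕ) : ℝ) ^ (2 * k) * (Real.sqrt m / n) ^ (2 * k) := by
        gcongr
        exact_mod_cast Nat.factorial_le_pow (2 * k)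
    _ = 1 * (2 * k * Real.sqrt m / n) ^ (2 * k) := by
        rw [← mul_pow, one_mul]; push_cast; ring
    _ ≤ 2 * Real.sqrt m * (2 * k * Real.sqrt m / n) ^ (2 * k) := by
        gcongr
        linarith
end

section
/- Let p ≥ 1, let n > 0 be real, and let (Q_ℓ)_{ℓ≥1} be a sequence of p×p substochastic real matrices. For 0 ≤ s ≤ t, define the double series P(s,t) := Σ_{ℓ≥0} Σ_{k≥0} Poi_{ns}(k)·Poi_{n(t−s)}(ℓ)·(Q_{k+1}Q_{k+2}⋯Q_{k+ℓ}), where the empty product (ℓ = 0) is the identity matrix. Then this double series converges absolutely entrywise, and the resulting matrix P(s,t) is substochastic: all its entries lie in [0,1] and each of its row sums is at most 1. -/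
/-- The Poisson probability mass function with mean `lam` evaluated at `m`. -/
noncomputable def poiPMF (lam : ℝ) (m : ℕ) : ℝ :=
  lam ^ m / (Nat.factorial m : ℝ) * Real.exp (-lam)

/-- A real square matrix is substochastic if all its entries are nonnegative and
each of its row sums is at most 1. -/
def Substochastic {p : ℕ} (A : Matrix (Fin p) (Fin p) ℝ) : Prop :=
  (∀ i j, 0 ≤ A i j) ∧ ∀ i, ∑ j, A i j ≤ 1

theorem poiPMF_nonneg {lam : ℝ} (h : 0 ≤ lam) (m : ℕ) : 0 ≤ poiPMF lam m := by
  unfold poiPMF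
  positivity

theorem hasSum_poiPMF {lam : ℝ} (h : 0 ≤ lam) : HasSum (poiPMF lam) 1 := by
  lift lam to NNReal using h
  convert ProbabilityTheory.hasSum_one_poissonMeasure lam using 2 with m
  rw [poiPMF]
  ring

namespace Substochastic

variable {p : ℕ} {A B : Matrix (Fin p) (Fin p) ℝ}

theorem one : Substochastic (1 : Matrix (Fin p) (Fin p) ℝ) := by
  refine ⟨fun i j => ?_, fun i => ?_⟩
  · rw [Matrix.one_apply]
    split_ifs <;> norm_num
  · simp [Matrix.one_apply]

theorem mul (hA : Substochastic A) (hB : Substochastic B) : Substochastic (A * B) := by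
  refine ⟨fun i j => ?_, fun i => ?_⟩
  · rw [Matrix.mul_apply]
    exact Finset.sum_nonneg fun k _ => mul_nonneg (hA.1 i k) (hB.1 k j)
  · calc ∑ j, (A * B) i j = ∑ k, A i k * ∑ j, B k j := by
          simp only [Matrix.mul_apply, Finset.mul_sum]
          exact Finset.sum_comm
      _ ≤ ∑ k, A i k :=
          Finset.sum_le_sum fun k _ => mul_le_of_le_one_right (hA.1 i k) (hB.2 k)
      _ ≤ 1 := hA.2 i

theorem list_prod {l : List (Matrix (Fin p) (Fin p) ℝ)} (h : ∀ A ∈ l, Substochastic A) :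
    Substochastic l.prod :=
  List.prod_induction Substochastic (fun _ _ => mul) one h

theorem apply_le_one (hA : Substochastic A) (i j : Fin p) : A i j ≤ 1 :=
  (Finset.single_le_sum (fun k _ => hA.1 i k) (Finset.mem_univ j)).trans (hA.2 i)

theorem summable_mul {ι : Type*} {w : ι → ℝ} {M : ι → Matrix (Fin p) (Fin p) ℝ}
    (hw : ∀ x, 0 ≤ w x) (hs : Summable w) (hM : ∀ x, Substochastic (M x)) (i j : Fin p) :
    Summable fun x => w x * M x i j :=
  hs.of_nonneg_of_le (fun x => mul_nonneg (hw x) ((hM x).1 i j))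
    fun x => mul_le_of_le_one_right (hw x) ((hM x).apply_le_one i j)

/-- A countable convex combination of substochastic matrices is substochastic. -/
theorem tsum_mul {ι : Type*} {w : ι → ℝ} {M : ι → Matrix (Fin p) (Fin p) ℝ}
    (hw : ∀ x, 0 ≤ w x) (hs : HasSum w 1) (hM : ∀ x, Substochastic (M x)) :
    Substochastic (Matrix.of fun i j => ∑' x, w x * M x i j) := by
  have hsum := summable_mul hw hs.summable hM
  refine ⟨fun i j => tsum_nonneg fun x => mul_nonneg (hw x) ((hM x).1 i j), fun i => ?_⟩
  simp only [Matrix.of_apply]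
  rw [← Summable.tsum_finsetSum fun j _ => hsum i j, ← hs.tsum_eq]
  refine Summable.tsum_le_tsum (fun x => ?_) (summable_sum fun j _ => hsum i j) hs.summable
  rw [← Finset.mul_sum]
  exact mul_le_of_le_one_right (hw x) ((hM x).2 i)

end Substochastic

/-- For substochastic matrices `(Q_ℓ)_{ℓ≥1}` and `0 ≤ s ≤ t`, the double
series `P(s,t) = Σ_{ℓ,k≥0} Poi_{ns}(k)·Poi_{n(t−s)}(ℓ)·(Q_{k+1}⋯Q_{k+ℓ})` converges
absolutely entrywise and the resulting matrix is substochastic, with all entries in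
`[0,1]`. -/
theorem stmt13
    (p : ℕ) (hp : 1 ≤ p) (n : ℝ) (hn : 0 < n)
    (Q : ℕ → Matrix (Fin p) (Fin p) ℝ)
    (hQ : ∀ ℓ, 1 ≤ ℓ → Substochastic (Q ℓ))
    (s t : ℝ) (hs : 0 ≤ s) (hst : s ≤ t) :
    (∀ i j : Fin p, Summable (fun kl : ℕ × ℕ =>
        |poiPMF (n * s) kl.1 * poiPMF (n * (t - s)) kl.2 *
          (((List.range kl.2).map (fun r => Q (kl.1 + 1 + r))).prod i j)|)) ∧
    (∀ i j : Fin p,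
      (∑' kl : ℕ × ℕ, poiPMF (n * s) kl.1 * poiPMF (n * (t - s)) kl.2 *
          (((List.range kl.2).map (fun r => Q (kl.1 + 1 + r))).prod i j))
        ∈ Set.Icc (0 : ℝ) 1) ∧
    ∀ i : Fin p,
      ∑ j : Fin p, (∑' kl : ℕ × ℕ, poiPMF (n * s) kl.1 * poiPMF (n * (t - s)) kl.2 *
          (((List.range kl.2).map (fun r => Q (kl.1 + 1 + r))).prod i j)) ≤ 1 := by
  have hns : 0 ≤ n * s := mul_nonneg hn.le hs
  have hnt : 0 ≤ n * (t - s) := mul_nonneg hn.le (sub_nonneg.2 hst)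
  have hw : ∀ kl : ℕ × ℕ, 0 ≤ poiPMF (n * s) kl.1 * poiPMF (n * (t - s)) kl.2 := fun kl =>
    mul_nonneg (poiPMF_nonneg hns _) (poiPMF_nonneg hnt _)
  have hws : HasSum (fun kl : ℕ × ℕ => poiPMF (n * s) kl.1 * poiPMF (n * (t - s)) kl.2) 1 := by
    have h1 := hasSum_poiPMF hns
    have h2 := hasSum_poiPMF hnt
    simpa using h1.mul h2
      (h1.summable.mul_of_nonneg h2.summable (poiPMF_nonneg hns) (poiPMF_nonneg hnt))
  have hM : ∀ kl : ℕ × ℕ,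
      Substochastic ((List.range kl.2).map (fun r => Q (kl.1 + 1 + r))).prod := by
    refine fun kl => Substochastic.list_prod fun A hA => ?_
    obtain ⟨r, -, rfl⟩ := List.mem_map.1 hA
    exact hQ _ (by omega)
  have hP := Substochastic.tsum_mul hw hws hM
  exact ⟨fun i j => (Substochastic.summable_mul hw hws.summable hM i j).abs,
    fun i j => ⟨hP.1 i j, hP.apply_le_one i j⟩, hP.2⟩
end

section
/- Let p ≥ 1, n > 0, M ∈ ℕ, and δ ≥ 0. Let (Q_ℓ)_{ℓ≥1} and (Q̂_ℓ)_{ℓ≥1} be sequences of p×p substochastic real matrices satisfying ‖Q_ℓ − Q̂_ℓ‖ ≤ δ in the ℓ∞-operator norm for all 1 ≤ ℓ ≤ M. For 0 ≤ s ≤ t define P(s,t) := Σ_{ℓ,k≥0} Poi_{ns}(k)·Poi_{n(t−s)}(ℓ)·(Q_{k+1}⋯Q_{k+ℓ}) and P̂(s,t) := Σ_{ℓ,k≥0} Poi_{ns}(k)·Poi_{n(t−s)}(ℓ)·(Q̂_{k+1}⋯Q̂_{k+ℓ}). Then ‖P(s,t) − P̂(s,t)‖ ≤ n·(t−s)·δ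 + 2·Σ_{m > M} Poi_{nt}(m). -/
/-- The ℓ∞-operator norm of a real square matrix: the maximum over rows of the
row-wise ℓ1 norm `Σ_j |A i j|`. -/
noncomputable def linftyNorm {p : ℕ} (A : Matrix (Fin p) (Fin p) ℝ) : ℝ :=
  ⨆ i, ∑ j, |A i j|

open scoped Matrix.Norms.Operator

lemma linftyNorm_eq_norm {p : ℕ} (A : Matrix (Fin p) (Fin p) ℝ) : linftyNorm A = ‖A‖ := by
  rw [Matrix.linfty_opNorm_def, Finset.sup_univ_eq_ciSup, NNReal.coe_iSup]
  simp [linftyNorm]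

lemma norm_le_of_forall_sum_abs_le {p : ℕ} {A : Matrix (Fin p) (Fin p) ℝ} {c : ℝ} (hc : 0 ≤ c)
    (h : ∀ i, ∑ j, |A i j| ≤ c) : ‖A‖ ≤ c := by
  rw [← linftyNorm_eq_norm]
  exact Real.iSup_le h hc

lemma Substochastic.norm_le_one {p : ℕ} {A : Matrix (Fin p) (Fin p) ℝ}
    (hA : Substochastic A) : ‖A‖ ≤ 1 :=
  norm_le_of_forall_sum_abs_le zero_le_one fun i => by
    simpa [abs_of_nonneg (hA.1 _ _)] using hA.2 i

lemma substochastic_one {p : ℕ} : Substochastic (1 : Matrix (Fin p) (Fin p) ℝ) := by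
  refine ⟨fun i j => ?_, fun i => ?_⟩
  · rw [Matrix.one_apply]
    split_ifs <;> norm_num
  · simp [Matrix.one_apply]

lemma norm_prod_range_le_one {p : ℕ} {Q : ℕ → Matrix (Fin p) (Fin p) ℝ}
    (hQ : ∀ r, ‖Q r‖ ≤ 1) (l : ℕ) : ‖((List.range l).map Q).prod‖ ≤ 1 := by
  induction l with
  | zero => simpa using (substochastic_one (p := p)).norm_le_one
  | succ l ih =>
    simp only [List.range_succ, List.map_append, List.prod_append, List.map_cons, List.map_nil,
      List.prod_singleton]
    exact (norm_mul_le _ _).trans (mul_le_one₀ ih (norm_nonneg _) (hQ l))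

lemma norm_prod_range_sub_le {p : ℕ} {Q R : ℕ → Matrix (Fin p) (Fin p) ℝ} {δ : ℝ}
    (hQ : ∀ r, ‖Q r‖ ≤ 1) (hR : ∀ r, ‖R r‖ ≤ 1) (l : ℕ) (h : ∀ r < l, ‖Q r - R r‖ ≤ δ) :
    ‖((List.range l).map Q).prod - ((List.range l).map R).prod‖ ≤ l * δ := by
  induction l with
  | zero => simp
  | succ l ih =>
    simp only [List.range_succ, List.map_append, List.prod_append, List.map_cons, List.map_nil,
      List.prod_singleton]
    set A := ((List.range l).map Q).prod
    set B := ((List.range l).map R).prod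
    have hB : ‖B‖ ≤ 1 := norm_prod_range_le_one hR l
    have hAB : ‖A - B‖ ≤ l * δ := ih fun r hr => h r (hr.trans l.lt_succ_self)
    calc ‖A * Q l - B * R l‖ = ‖(A - B) * Q l + B * (Q l - R l)‖ := by
          congr 1
          noncomm_ring
      _ ≤ ‖A - B‖ * ‖Q l‖ + ‖B‖ * ‖Q l - R l‖ :=
          (norm_add_le _ _).trans (add_le_add (norm_mul_le _ _) (norm_mul_le _ _))
      _ ≤ ‖A - B‖ * 1 + 1 * ‖Q l - R l‖ := by
          gcongr
          exact hQ l
      _ ≤ (l + 1 : ℕ) * δ := by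
          push_cast
          linarith [h l l.lt_succ_self]

lemma poiPMF_nonneg_s14 {a : ℝ} (ha : 0 ≤ a) (m : ℕ) : 0 ≤ poiPMF a m := by
  unfold poiPMF
  positivity

lemma hasSum_poiPMF_s14 (a : ℝ) : HasSum (poiPMF a) 1 := by
  have h := (NormedSpace.expSeries_div_hasSum_exp a).mul_right (Real.exp (-a))
  rwa [← Real.exp_eq_exp_ℝ, ← Real.exp_add, add_neg_cancel, Real.exp_zero] at h

lemma hasSum_natCast_mul_poiPMF (a : ℝ) : HasSum (fun m : ℕ => m * poiPMF a m) a := by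
  rw [← hasSum_nat_add_iff' 1]
  have h := (hasSum_poiPMF_s14 a).mul_left a
  simp only [mul_one] at h
  simp only [Finset.sum_range_one, Nat.cast_zero, zero_mul, sub_zero]
  refine h.congr_fun fun m => ?_
  simp only [poiPMF, Nat.factorial_succ]
  push_cast
  field_simp
  ring

lemma sum_antidiagonal_poiPMF (a b : ℝ) (m : ℕ) :
    ∑ kl ∈ Finset.HasAntidiagonal.antidiagonal m, poiPMF a kl.1 * poiPMF b kl.2 = poiPMF (a + b) m := by
  simp only [poiPMF]
  rw [(Commute.all a b).add_pow', Finset.sum_div, Finset.sum_mul]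
  refine Finset.sum_congr rfl fun kl hkl => ?_
  rw [Finset.HasAntidiagonal.mem_antidiagonal] at hkl
  subst hkl
  rw [nsmul_eq_mul, Nat.cast_add_choose, neg_add, Real.exp_add]
  have := Nat.factorial_ne_zero (kl.1 + kl.2)
  field_simp

lemma hasSum_poiPMF_mul {a b : ℝ} (ha : 0 ≤ a) (hb : 0 ≤ b) :
    HasSum (fun kl : ℕ × ℕ => poiPMF a kl.1 * poiPMF b kl.2) 1 := by
  have h := (hasSum_poiPMF_s14 a).mul (hasSum_poiPMF_s14 b)
    ((hasSum_poiPMF_s14 a).summable.mul_of_nonneg (hasSum_poiPMF_s14 b).summable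
      (poiPMF_nonneg_s14 ha) (poiPMF_nonneg_s14 hb))
  rwa [mul_one] at h

lemma hasSum_poiPMF_mul_mul_snd {a b : ℝ} (ha : 0 ≤ a) (hb : 0 ≤ b) :
    HasSum (fun kl : ℕ × ℕ => poiPMF a kl.1 * poiPMF b kl.2 * kl.2) b := by
  have h := (hasSum_poiPMF_s14 a).mul (hasSum_natCast_mul_poiPMF b)
    ((hasSum_poiPMF_s14 a).summable.mul_of_nonneg (hasSum_natCast_mul_poiPMF b).summable
      (poiPMF_nonneg_s14 ha) fun m => mul_nonneg m.cast_nonneg (poiPMF_nonneg_s14 hb m))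
  rw [one_mul] at h
  exact h.congr_fun fun kl => by ring

lemma hasSum_poiPMF_mul_tail {a b : ℝ} (ha : 0 ≤ a) (hb : 0 ≤ b) (M : ℕ) :
    HasSum (fun kl : ℕ × ℕ => if M < kl.1 + kl.2 then poiPMF a kl.1 * poiPMF b kl.2 else 0)
      (∑' m : {m : ℕ // M < m}, poiPMF (a + b) m.val) := by
  have hs : Summable fun kl : ℕ × ℕ =>
      if M < kl.1 + kl.2 then poiPMF a kl.1 * poiPMF b kl.2 else 0 :=
    ((hasSum_poiPMF_mul ha hb).summable.indicator {kl : ℕ × ℕ | M < kl.1 + kl.2}).congr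
      fun kl => by simp [Set.indicator_apply]
  convert hs.hasSum using 1
  have hσ := (Finset.HasAntidiagonal.sigmaAntidiagonalEquivProd.summable_iff).2 hs
  rw [← Finset.HasAntidiagonal.sigmaAntidiagonalEquivProd.tsum_eq]
  refine Eq.trans ?_ hσ.tsum_sigma.symm
  rw [show (∑' m : {m : ℕ // M < m}, poiPMF (a + b) m.val) = _ from
    tsum_subtype {m : ℕ | M < m} (poiPMF (a + b))]
  refine tsum_congr fun m => ?_
  rw [tsum_fintype, Finset.univ_eq_attach]
  simp only [Function.comp_apply, Finset.HasAntidiagonal.sigmaAntidiagonalEquivProd_apply]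
  rw [Finset.sum_attach (Finset.HasAntidiagonal.antidiagonal m) fun kl =>
    if M < kl.1 + kl.2 then poiPMF a kl.1 * poiPMF b kl.2 else 0,
    Set.indicator_apply, ← sum_antidiagonal_poiPMF]
  by_cases hm : M < m
  · rw [if_pos (show m ∈ {m : ℕ | M < m} from hm)]
    refine Finset.sum_congr rfl fun kl hkl => ?_
    rw [Finset.HasAntidiagonal.mem_antidiagonal.1 hkl, if_pos hm]
  · rw [if_neg (show m ∉ {m : ℕ | M < m} from hm)]
    refine (Finset.sum_eq_zero fun kl hkl => ?_).symm
    rw [Finset.HasAntidiagonal.mem_antidiagonal.1 hkl, if_neg hm]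

/-- If `(Q_ℓ)` and `(Q̂_ℓ)` are substochastic with `‖Q_ℓ − Q̂_ℓ‖ ≤ δ` for
`1 ≤ ℓ ≤ M`, then the associated Poisson-mixture transition matrices
`P(s,t) = Σ_{ℓ,k≥0} Poi_{ns}(k)·Poi_{n(t−s)}(ℓ)·(Q_{k+1}⋯Q_{k+ℓ})` satisfy
`‖P(s,t) − P̂(s,t)‖ ≤ n·(t−s)·δ + 2·Σ_{m>M} Poi_{nt}(m)`. -/
theorem stmt14
    (p : ℕ) (hp : 1 ≤ p) (n : ℝ) (hn : 0 < n) (M : ℕ) (δ : ℝ) (hδ : 0 ≤ δ)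
    (Q Qhat : ℕ → Matrix (Fin p) (Fin p) ℝ)
    (hQ : ∀ ℓ, 1 ≤ ℓ → Substochastic (Q ℓ))
    (hQhat : ∀ ℓ, 1 ≤ ℓ → Substochastic (Qhat ℓ))
    (hclose : ∀ ℓ, 1 ≤ ℓ → ℓ ≤ M → linftyNorm (Q ℓ - Qhat ℓ) ≤ δ)
    (s t : ℝ) (hs : 0 ≤ s) (hst : s ≤ t) :
    linftyNorm
        ((∑' kl : ℕ × ℕ, (poiPMF (n * s) kl.1 * poiPMF (n * (t - s)) kl.2) •
            ((List.range kl.2).map (fun r => Q (kl.1 + 1 + r))).prod)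
          - ∑' kl : ℕ × ℕ, (poiPMF (n * s) kl.1 * poiPMF (n * (t - s)) kl.2) •
            ((List.range kl.2).map (fun r => Qhat (kl.1 + 1 + r))).prod)
      ≤ n * (t - s) * δ + 2 * ∑' m : {m : ℕ // M < m}, poiPMF (n * t) m.val := by
  set a := n * s
  set b := n * (t - s)
  have ha : 0 ≤ a := mul_nonneg hn.le hs
  have hb : 0 ≤ b := mul_nonneg hn.le (sub_nonneg.2 hst)
  have hab : n * t = a + b := by ring
  have hw (kl : ℕ × ℕ) : 0 ≤ poiPMF a kl.1 * poiPMF b kl.2 :=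
    mul_nonneg (poiPMF_nonneg_s14 ha _) (poiPMF_nonneg_s14 hb _)
  have hsum {R : ℕ → Matrix (Fin p) (Fin p) ℝ} (hR : ∀ ℓ, 1 ≤ ℓ → Substochastic (R ℓ)) :
      Summable fun kl : ℕ × ℕ => (poiPMF a kl.1 * poiPMF b kl.2) •
        ((List.range kl.2).map fun r => R (kl.1 + 1 + r)).prod := by
    refine (hasSum_poiPMF_mul ha hb).summable.of_norm_bounded fun kl => ?_
    rw [norm_smul, Real.norm_of_nonneg (hw kl)]
    exact mul_le_of_le_one_right (hw kl)
      (norm_prod_range_le_one (fun r => (hR _ (by lia)).norm_le_one) _)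
  rw [linftyNorm_eq_norm, ← (hsum hQ).tsum_sub (hsum hQhat), hab]
  refine tsum_of_norm_bounded (((hasSum_poiPMF_mul_mul_snd ha hb).mul_right δ).add
    ((hasSum_poiPMF_mul_tail ha hb M).mul_left 2)) fun kl => ?_
  rw [← smul_sub, norm_smul, Real.norm_of_nonneg (hw kl)]
  have hA := norm_prod_range_le_one (fun r => (hQ (kl.1 + 1 + r) (by lia)).norm_le_one) kl.2
  have hB := norm_prod_range_le_one (fun r => (hQhat (kl.1 + 1 + r) (by lia)).norm_le_one) kl.2
  split_ifs with hM
  · have hAB := (norm_sub_le _ _).trans (add_le_add hA hB)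
    have hδ' : 0 ≤ poiPMF a kl.1 * poiPMF b kl.2 * kl.2 * δ :=
      mul_nonneg (mul_nonneg (hw kl) kl.2.cast_nonneg) hδ
    linarith [mul_le_mul_of_nonneg_left hAB (hw kl)]
  · rw [mul_zero, add_zero, mul_assoc _ (kl.2 : ℝ)]
    refine mul_le_mul_of_nonneg_left (norm_prod_range_sub_le
      (fun r => (hQ (kl.1 + 1 + r) (by lia)).norm_le_one)
      (fun r => (hQhat (kl.1 + 1 + r) (by lia)).norm_le_one) _
      fun r hr => ?_) (hw kl)
    rw [← linftyNorm_eq_norm]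
    exact hclose _ (by lia) (by lia)
end
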